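/- arXiv:2511.09281 — 3 statements merged into one kernel-verified Lean document; each statement's English description precedes it below -/
import Mathlib

section
/- Let φ, δ : ℝ → ℝ be even, nonnegative, bounded, measurable functions with compact support, both nonincreasing on (0,∞), and set ψ(x) = |x| δ(x). Then ∫_ℝ 𝓕φ(x) ψ(x) dx ≥ 0. -/
open MeasureTheory

/-- The Fourier transform on `ℝ` with the convention `𝓕g(ξ) = ∫ g(x) e^{-i x ξ} dx`.
For an even real integrable `g`, `𝓕g` is real-valued. -/
noncomputable def FT (f : ℝ → ℝ) (ξ : ℝ) : ℂ :=
  ∫ x : ℝ, (f x : ℂ) * Complex.exp (-Complex.I * x * ξ)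

open Set

/-- If `f` is bounded, nonnegative and nonincreasing on `(0,∞)` and all the integrals of `g` over
`(0,c]` with `0 ≤ c ≤ R` are nonnegative, then so is the integral of `f * g` over `(0,R]`. -/
theorem setIntegral_mul_nonneg_of_antitoneOn {f g : ℝ → ℝ} {M R : ℝ} (hfm : Measurable f)
    (hf0 : ∀ x, 0 ≤ f x) (hfM : ∀ x, f x ≤ M) (hfa : AntitoneOn f (Ioi 0))
    (hg : IntegrableOn g (Ioc 0 R))
    (hG : ∀ c, 0 ≤ c → c ≤ R → 0 ≤ ∫ x in Ioc 0 c, g x) :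
    0 ≤ ∫ x in Ioc 0 R, f x * g x := by
  have hS : MeasurableSet {p : ℝ × ℝ | p.2 < f p.1} :=
    measurableSet_lt measurable_snd (hfm.comp measurable_fst)
  have hint : Integrable ({p : ℝ × ℝ | p.2 < f p.1}.indicator fun p => g p.1)
      ((volume.restrict (Ioc 0 R)).prod (volume.restrict (Ioc 0 M))) :=
    (hg.comp_fst (volume.restrict (Ioc 0 M))).indicator hS
  have hlayer : ∀ x, f x * g x =
      ∫ t in Ioc 0 M, {p : ℝ × ℝ | p.2 < f p.1}.indicator (fun p => g p.1) (x, t) := by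
    intro x
    have h1 : ∀ t, {p : ℝ × ℝ | p.2 < f p.1}.indicator (fun p => g p.1) (x, t) =
        (Iio (f x)).indicator (fun _ => g x) t := fun t => by
      simp [indicator_apply]
    simp_rw [h1]
    rw [integral_indicator measurableSet_Iio, Measure.restrict_restrict measurableSet_Iio,
      setIntegral_const]
    have h2 : Iio (f x) ∩ Ioc 0 M = Ioo 0 (f x) := by
      ext t
      simp only [mem_inter_iff, mem_Iio, mem_Ioc, mem_Ioo]
      exact ⟨fun h => ⟨h.2.1, h.1⟩, fun h => ⟨h.2, h.1, h.2.le.trans (hfM x)⟩⟩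
    rw [h2, Real.volume_real_Ioo_of_le (hf0 x)]
    simp
  simp_rw [hlayer]
  rw [integral_integral_swap
    (f := fun x t => {p : ℝ × ℝ | p.2 < f p.1}.indicator (fun p => g p.1) (x, t)) hint]
  refine integral_nonneg fun t => ?_
  have h1 : ∀ x, {p : ℝ × ℝ | p.2 < f p.1}.indicator (fun p => g p.1) (x, t) =
      {x | t < f x}.indicator g x := fun x => by
    simp [indicator_apply]
  have hT : MeasurableSet {x | t < f x} := measurableSet_lt measurable_const hfm
  simp only [h1, Pi.zero_apply]
  rw [integral_indicator hT, Measure.restrict_restrict hT]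
  set A := {x | t < f x} ∩ Ioc 0 R with hA
  rcases A.eq_empty_or_nonempty with he | ⟨z, hz⟩
  · simp [he]
  have hbdd : BddAbove A := ⟨R, fun x hx => hx.2.2⟩
  have hc0 : 0 ≤ sSup A := hz.2.1.le.trans (le_csSup hbdd hz)
  have hcR : sSup A ≤ R := csSup_le ⟨z, hz⟩ fun x hx => hx.2.2
  have hsub : A ⊆ Ioc 0 (sSup A) := fun x hx => ⟨hx.2.1, le_csSup hbdd hx⟩
  have hsup : Ioo 0 (sSup A) ⊆ A := by
    intro x hx
    obtain ⟨y, hy, hxy⟩ := exists_lt_of_lt_csSup ⟨z, hz⟩ hx.2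
    exact ⟨lt_of_lt_of_le hy.1 (hfa hx.1 hy.2.1 hxy.le), hx.1, hxy.le.trans hy.2.2⟩
  have hae : A =ᵐ[volume] Ioc 0 (sSup A) :=
    Filter.EventuallyLE.antisymm (LE.le.eventuallyLE hsub)
      (Ioo_ae_eq_Ioc.symm.le.trans (LE.le.eventuallyLE hsup))
  rw [setIntegral_congr_set hae]
  exact hG _ hc0 hcR

theorem integrable_prod_mul_cos {μ ν : Measure ℝ} [SFinite μ] [SFinite ν] {u v : ℝ → ℝ}
    (hu : Integrable u μ) (hv : Integrable v ν) :
    Integrable (fun p : ℝ × ℝ => u p.1 * v p.2 * Real.cos (p.2 * p.1)) (μ.prod ν) :=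
  (hu.mul_prod hv).mul_bdd (c := 1)
    (by fun_prop) (Filter.Eventually.of_forall fun p => Real.abs_cos_le_one _)

theorem setIntegral_mul_cos_nonneg {a b : ℝ} (ha : 0 ≤ a) (hb : 0 ≤ b) :
    0 ≤ ∫ y in Ioc 0 a, ∫ x in Ioc 0 b, x * Real.cos (y * x) := by
  have hu : IntegrableOn (fun x : ℝ => x) (Ioc 0 b) := continuous_id.integrableOn_Ioc
  have hv : IntegrableOn (fun _ : ℝ => (1 : ℝ)) (Ioc 0 a) := continuous_const.integrableOn_Ioc
  have hp := integrable_prod_mul_cos hu hv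
  simp only [mul_one] at hp
  rw [← integral_integral_swap (f := fun x y => x * Real.cos (y * x)) hp]
  have hin : ∀ x ∈ Ioc 0 b, ∫ y in Ioc 0 a, x * Real.cos (y * x) = Real.sin (a * x) := by
    intro x hx
    rw [← intervalIntegral.integral_of_le ha, intervalIntegral.integral_const_mul,
      intervalIntegral.mul_integral_comp_mul_right, integral_cos]
    simp
  rw [setIntegral_congr_fun measurableSet_Ioc hin]
  rcases ha.eq_or_lt with rfl | ha'
  · simp
  rw [← intervalIntegral.integral_of_le hb]
  have h := intervalIntegral.mul_integral_comp_mul_left (a := 0) (b := b) (f := Real.sin) a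
  rw [integral_sin] at h
  refine nonneg_of_mul_nonneg_right (a := a) ?_ ha'
  rw [h]
  simpa using Real.cos_le_one (a * b)

theorem setIntegral_mul_setIntegral_mul_cos_nonneg {φ δ : ℝ → ℝ} {M N R S : ℝ}
    (hφm : Measurable φ) (hδm : Measurable δ) (hφ0 : ∀ x, 0 ≤ φ x) (hδ0 : ∀ x, 0 ≤ δ x)
    (hφM : ∀ x, φ x ≤ M) (hδN : ∀ x, δ x ≤ N)
    (hφi : IntegrableOn φ (Ioc 0 R))
    (hφa : AntitoneOn φ (Ioi 0)) (hδa : AntitoneOn δ (Ioi 0)) :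
    0 ≤ ∫ x in Ioc 0 S, δ x * ∫ y in Ioc 0 R, x * φ y * Real.cos (y * x) := by
  have hu : ∀ b : ℝ, IntegrableOn (fun x : ℝ => x) (Ioc 0 b) :=
    fun b => continuous_id.integrableOn_Ioc
  have hv : IntegrableOn (fun _ : ℝ => (1 : ℝ)) (Ioc 0 R) := continuous_const.integrableOn_Ioc
  refine setIntegral_mul_nonneg_of_antitoneOn hδm hδ0 hδN hδa
    (integrable_prod_mul_cos (hu S) hφi).integral_prod_left fun b hb _ => ?_
  rw [integral_integral_swap (f := fun x y => x * φ y * Real.cos (y * x))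
    (integrable_prod_mul_cos (hu b) hφi)]
  have hcomm : ∀ y x : ℝ, x * φ y * Real.cos (y * x) = φ y * (x * Real.cos (y * x)) :=
    fun y x => by ring
  simp_rw [hcomm, integral_const_mul]
  have hp := (integrable_prod_mul_cos (hu b) hv).integral_prod_right
  simp only [mul_one] at hp
  exact setIntegral_mul_nonneg_of_antitoneOn hφm hφ0 hφM hφa hp
    fun c hc _ => setIntegral_mul_cos_nonneg hc hb

theorem HasCompactSupport.exists_eq_zero_of_lt_abs {f : ℝ → ℝ} (hf : HasCompactSupport f) :
    ∃ R, ∀ x, R < |x| → f x = 0 := by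
  obtain ⟨R, hR⟩ := hf.isCompact.isBounded.subset_closedBall (0 : ℝ)
  refine ⟨R, fun x hx => ?_⟩
  by_contra h
  have h1 := hR (subset_tsupport f h)
  rw [mem_closedBall_zero_iff, Real.norm_eq_abs] at h1
  exact absurd hx h1.not_gt

theorem integral_even_eq_two_mul_setIntegral {f : ℝ → ℝ} {R : ℝ} (hfe : ∀ x, f (-x) = f x)
    (hfR : ∀ x, R < |x| → f x = 0) : ∫ x, f x = 2 * ∫ x in Ioc 0 R, f x := by
  have habs : ∀ x, f |x| = f x := fun x => by
    rcases abs_choice x with h | h <;> rw [h]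
    exact hfe x
  have h := integral_comp_abs (f := f)
  simp_rw [habs] at h
  rw [h, setIntegral_eq_of_subset_of_forall_sdiff_eq_zero measurableSet_Ioi
    (Ioc_subset_Ioi_self : Ioc 0 R ⊆ Ioi 0)]
  intro x hx
  refine hfR x (lt_of_not_ge fun hle => hx.2 ⟨hx.1, (le_abs_self x).trans hle⟩)

theorem re_FT {φ : ℝ → ℝ} (hφ : Integrable φ) (ξ : ℝ) :
    (FT φ ξ).re = ∫ y, φ y * Real.cos (y * ξ) := by
  have hexp : ∀ y : ℝ, Complex.exp (-Complex.I * y * ξ) =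
      Complex.exp ((-(y * ξ) : ℝ) * Complex.I) := fun y => by
    congr 1; push_cast; ring
  have hint : Integrable fun y : ℝ => (φ y : ℂ) * Complex.exp (-Complex.I * y * ξ) := by
    refine hφ.ofReal.mul_bdd (c := 1) (by fun_prop) (Filter.Eventually.of_forall fun y => ?_)
    rw [hexp, Complex.norm_exp_ofReal_mul_I]
  have h := integral_re hint
  simp only [RCLike.re_eq_complex_re] at h
  rw [FT, ← h]
  refine integral_congr_ae (Filter.Eventually.of_forall fun y => ?_)
  simp only [hexp, Complex.re_ofReal_mul, Complex.exp_ofReal_mul_I_re, Real.cos_neg]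

/-- if `φ, δ : ℝ → ℝ` are even, nonnegative, bounded, measurable,
compactly supported and nonincreasing on `(0,∞)`, and `ψ(x) = |x| δ(x)`, then
`∫_ℝ 𝓕φ(x) ψ(x) dx ≥ 0`. -/
theorem stmt1 (φ δ : ℝ → ℝ)
    (hφm : Measurable φ) (hδm : Measurable δ)
    (hφe : ∀ x, φ (-x) = φ x) (hδe : ∀ x, δ (-x) = δ x)
    (hφ0 : ∀ x, 0 ≤ φ x) (hδ0 : ∀ x, 0 ≤ δ x)
    (hφb : ∃ M, ∀ x, φ x ≤ M) (hδb : ∃ M, ∀ x, δ x ≤ M)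
    (hφs : HasCompactSupport φ) (hδs : HasCompactSupport δ)
    (hφa : AntitoneOn φ (Set.Ioi 0)) (hδa : AntitoneOn δ (Set.Ioi 0)) :
    0 ≤ (∫ x : ℝ, FT φ x * ((|x| * δ x : ℝ) : ℂ)).re := by
  obtain ⟨M, hM⟩ := hφb
  obtain ⟨N, hN⟩ := hδb
  obtain ⟨R, hφR⟩ := hφs.exists_eq_zero_of_lt_abs
  obtain ⟨S, hδS⟩ := hδs.exists_eq_zero_of_lt_abs
  have hφi : Integrable φ := by
    rw [← integrableOn_iff_integrable_of_support_subset (subset_tsupport φ)]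
    refine Measure.integrableOn_of_bounded (M := M) hφs.isCompact.measure_lt_top.ne
      hφm.aestronglyMeasurable (Filter.Eventually.of_forall fun x => ?_)
    rw [Real.norm_of_nonneg (hφ0 x)]
    exact hM x
  by_cases hint : Integrable fun x : ℝ => FT φ x * ((|x| * δ x : ℝ) : ℂ)
  swap
  · rw [integral_undef hint, Complex.zero_re]
  have hre := integral_re hint
  simp only [RCLike.re_eq_complex_re, Complex.re_mul_ofReal, re_FT hφi] at hre
  rw [← hre, integral_even_eq_two_mul_setIntegral (R := S)]
  · refine mul_nonneg zero_le_two ?_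
    have hker : ∀ x ∈ Ioc 0 S, (∫ y, φ y * Real.cos (y * x)) * (|x| * δ x) =
        2 * (δ x * ∫ y in Ioc 0 R, x * φ y * Real.cos (y * x)) := by
      intro x hx
      rw [integral_even_eq_two_mul_setIntegral (R := R)
        (fun y => by rw [hφe, neg_mul, Real.cos_neg]) (fun y hy => by rw [hφR y hy, zero_mul]),
        abs_of_pos hx.1]
      simp_rw [mul_assoc, integral_const_mul]
      ring
    rw [setIntegral_congr_fun measurableSet_Ioc hker, integral_const_mul]
    exact mul_nonneg zero_le_two (setIntegral_mul_setIntegral_mul_cos_nonneg hφm hδm hφ0 hδ0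
      hM hN hφi.integrableOn hφa hδa)
  · intro x
    simp only [mul_neg, Real.cos_neg, abs_neg, hδe]
  · intro x hx
    rw [hδS x hx, mul_zero, mul_zero]
end

section
/- Let φ, ψ : ℝ → ℝ be nonnegative, even, measurable functions such that φ is nonincreasing on (0,∞) and x ↦ ψ(x)/x is nonincreasing on (0,∞). If φ is bounded with compact support and the function x ↦ ψ(x) · min{1, 1/|x|} is integrable on ℝ, then ∫_ℝ 𝓕φ(x) ψ(x) dx ≥ 0. -/
open MeasureTheory

/-- The superlevel sets of a function antitone on `(0, ∞)` that vanishes far out are, up to null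
sets, intervals `(0, T)`. -/
lemma setIntegral_superlevel_nonneg {g k : ℝ → ℝ} {R s : ℝ} (hs : 0 ≤ s)
    (hga : AntitoneOn g (Set.Ioi 0)) (hgR : ∀ x, R < x → g x = 0)
    (hk : ∀ T, 0 < T → 0 ≤ ∫ x in Set.Ioo 0 T, k x) :
    0 ≤ ∫ x in Set.Ioi 0 ∩ {x | s < g x}, k x := by
  set A : Set ℝ := Set.Ioi 0 ∩ {x | s < g x} with hA
  rcases A.eq_empty_or_nonempty with hE | ⟨a, ha⟩
  · simp [hE]
  have hbdd : BddAbove A := by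
    refine ⟨R, fun x hx => ?_⟩
    by_contra! h
    have h1 : s < g x := hx.2
    rw [hgR x h] at h1
    linarith
  have hT : 0 < sSup A := lt_of_lt_of_le ha.1 (le_csSup hbdd ha)
  have hlow : Set.Ioo 0 (sSup A) ⊆ A := by
    intro x hx
    obtain ⟨y, hy, hxy⟩ := exists_lt_of_lt_csSup ⟨a, ha⟩ hx.2
    exact ⟨hx.1, lt_of_lt_of_le hy.2 (hga hx.1 hy.1 hxy.le)⟩
  have hup : A ⊆ Set.Ioc 0 (sSup A) := fun x hx => ⟨hx.1, le_csSup hbdd hx⟩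
  have hae : A =ᵐ[volume] Set.Ioo 0 (sSup A) := by
    refine Filter.EventuallyLE.antisymm ?_ hlow.eventuallyLE
    exact hup.eventuallyLE.trans Ioo_ae_eq_Ioc.symm.le
  rw [setIntegral_congr_set hae]
  exact hk _ hT

/-- If all the integrals of `k` over `(0, T)` are nonnegative, then so is the integral of `k` against
a nonnegative weight that is antitone on `(0, ∞)` and vanishes far out. -/
lemma integral_mul_antitoneOn_nonneg {g k : ℝ → ℝ} {R : ℝ} (hgm : Measurable g)
    (hkm : AEStronglyMeasurable k (volume.restrict (Set.Ioi 0)))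
    (hg0 : ∀ x, 0 < x → 0 ≤ g x) (hga : AntitoneOn g (Set.Ioi 0)) (hgR : ∀ x, R < x → g x = 0)
    (hkg : IntegrableOn (fun x => k x * g x) (Set.Ioi 0))
    (hk : ∀ T, 0 < T → 0 ≤ ∫ x in Set.Ioo 0 T, k x) :
    0 ≤ ∫ x in Set.Ioi 0, k x * g x := by
  have hS : MeasurableSet {p : ℝ × ℝ | p.2 < g p.1} :=
    measurableSet_lt measurable_snd (hgm.comp measurable_fst)
  let F : ℝ → ℝ → ℝ := fun x s => k x * (Set.Iio (g x)).indicator (fun _ => (1 : ℝ)) s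
  have hind : ∀ x, 0 < x →
      ∫ s in Set.Ioi 0, (Set.Iio (g x)).indicator (fun _ => (1 : ℝ)) s = g x := by
    intro x hx
    rw [integral_indicator measurableSet_Iio, Measure.restrict_restrict measurableSet_Iio,
      Set.Iio_inter_Ioi]
    simp [hg0 x hx]
  have hindi : ∀ x, IntegrableOn ((Set.Iio (g x)).indicator (fun _ => (1 : ℝ))) (Set.Ioi 0) := by
    intro x
    rw [IntegrableOn, integrable_indicator_iff measurableSet_Iio, IntegrableOn,
      Measure.restrict_restrict measurableSet_Iio, Set.Iio_inter_Ioi]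
    exact integrableOn_const (by simp)
  have hFm : AEStronglyMeasurable (Function.uncurry F)
      ((volume.restrict (Set.Ioi 0)).prod (volume.restrict (Set.Ioi 0))) := by
    refine hkm.comp_fst.mul ?_
    exact ((measurable_const (a := (1 : ℝ))).indicator hS).aestronglyMeasurable
  have hFi : Integrable (Function.uncurry F)
      ((volume.restrict (Set.Ioi 0)).prod (volume.restrict (Set.Ioi 0))) := by
    rw [integrable_prod_iff hFm]
    refine ⟨Filter.Eventually.of_forall fun x => (hindi x).const_mul (k x), ?_⟩
    refine hkg.norm.congr ?_
    filter_upwards [ae_restrict_mem measurableSet_Ioi] with x hx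
    have : ∀ s, ‖Function.uncurry F (x, s)‖
        = |k x| * (Set.Iio (g x)).indicator (fun _ => (1 : ℝ)) s := by
      intro s
      simp only [Function.uncurry, F, norm_mul, Real.norm_eq_abs]
      congr 1
      exact abs_of_nonneg (Set.indicator_nonneg (fun _ _ => zero_le_one) _)
    simp only [this]
    rw [integral_const_mul, hind x hx, norm_mul, Real.norm_eq_abs, Real.norm_eq_abs,
      abs_of_nonneg (hg0 x hx)]
  have hlayer : ∫ x in Set.Ioi 0, k x * g x = ∫ x in Set.Ioi 0, ∫ s in Set.Ioi 0, F x s := by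
    refine setIntegral_congr_fun measurableSet_Ioi fun x hx => ?_
    simp only [F]
    rw [integral_const_mul, hind x hx]
  rw [hlayer, integral_integral_swap hFi]
  refine setIntegral_nonneg measurableSet_Ioi fun s hs => ?_
  have hFs : ∀ x, F x s = {x | s < g x}.indicator k x := by
    intro x
    by_cases h : s < g x <;> simp [F, Set.indicator, h]
  simp only [hFs]
  rw [setIntegral_indicator (measurableSet_lt measurable_const hgm)]
  exact setIntegral_superlevel_nonneg (le_of_lt hs) hga hgR hk

lemma integral_Ioo_sin_mul_nonneg {t T : ℝ} (ht : 0 < t) (hT : 0 < T) :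
    0 ≤ ∫ x in Set.Ioo 0 T, Real.sin (t * x) := by
  rw [← integral_Ioc_eq_integral_Ioo, ← intervalIntegral.integral_of_le hT.le,
    intervalIntegral.integral_comp_mul_left (fun y => Real.sin y) ht.ne', integral_sin]
  have := Real.cos_le_one (t * T)
  simp only [mul_zero, Real.cos_zero, smul_eq_mul]
  have := inv_nonneg.2 ht.le
  apply mul_nonneg <;> linarith

lemma integral_Ioo_cos_mul {ξ T : ℝ} (hξ : 0 < ξ) (hT : 0 < T) :
    ∫ x in Set.Ioo 0 T, Real.cos (x * ξ) = Real.sin (T * ξ) / ξ := by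
  rw [← integral_Ioc_eq_integral_Ioo, ← intervalIntegral.integral_of_le hT.le,
    intervalIntegral.integral_comp_mul_right (fun y => Real.cos y) hξ.ne', integral_cos]
  simp [div_eq_inv_mul]

lemma integrable_mul_mul_cos {u v : ℝ → ℝ} {μ ν : Measure ℝ} [SFinite μ] [SFinite ν]
    (hu : Integrable u μ) (hv : Integrable v ν) :
    Integrable (fun p : ℝ × ℝ => u p.1 * v p.2 * Real.cos (p.2 * p.1)) (μ.prod ν) := by
  refine (hu.mul_prod hv).mul_bdd (c := 1) ?_ ?_
  · exact (by fun_prop : Continuous fun p : ℝ × ℝ => Real.cos (p.2 * p.1)).aestronglyMeasurable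
  · exact Filter.Eventually.of_forall fun p => Real.abs_cos_le_one _

/-- The truncated cosine transform of `ψ` has nonnegative integral over every `(0, T)`. -/
lemma integral_Ioo_truncated_cos_nonneg {ψ : ℝ → ℝ} {N T : ℝ} (hψm : Measurable ψ)
    (hψ0 : ∀ x, 0 ≤ ψ x) (hψa : AntitoneOn (fun x => ψ x / x) (Set.Ioi 0))
    (hψN : IntegrableOn ψ (Set.Ioc 0 N)) (hT : 0 < T) :
    0 ≤ ∫ x in Set.Ioo 0 T, ∫ ξ in Set.Ioc 0 N, ψ ξ * Real.cos (x * ξ) := by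
  have h1 : Integrable (fun _ : ℝ => (1 : ℝ)) (volume.restrict (Set.Ioo 0 T)) :=
    integrableOn_const (by simp)
  have hi := integrable_mul_mul_cos hψN h1
  simp only [mul_one] at hi
  rw [← integral_integral_swap (f := fun ξ x => ψ ξ * Real.cos (x * ξ)) hi]
  let g : ℝ → ℝ := (Set.Iic N).indicator fun ξ => ψ ξ / ξ
  have key : ∀ ξ ∈ Set.Ioc 0 N,
      ∫ x in Set.Ioo 0 T, ψ ξ * Real.cos (x * ξ) = Real.sin (T * ξ) * (ψ ξ / ξ) := by
    intro ξ hξ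
    rw [integral_const_mul, integral_Ioo_cos_mul hξ.1 hT]
    ring
  have hgind : ∀ ξ, Real.sin (T * ξ) * g ξ
      = (Set.Iic N).indicator (fun ξ => Real.sin (T * ξ) * (ψ ξ / ξ)) ξ := by
    intro ξ
    by_cases h : ξ ∈ Set.Iic N <;> simp [g, Set.indicator, h]
  rw [setIntegral_congr_fun measurableSet_Ioc key]
  have hrw : ∫ ξ in Set.Ioc 0 N, Real.sin (T * ξ) * (ψ ξ / ξ)
      = ∫ ξ in Set.Ioi 0, Real.sin (T * ξ) * g ξ := by
    simp only [hgind]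
    rw [setIntegral_indicator measurableSet_Iic, Set.Ioi_inter_Iic]
  rw [hrw]
  refine integral_mul_antitoneOn_nonneg (R := N) ?_ ?_ ?_ ?_ ?_ ?_
    fun T' hT' => integral_Ioo_sin_mul_nonneg hT hT'
  · exact (hψm.div measurable_id).indicator measurableSet_Iic
  · exact (by fun_prop : Continuous fun ξ => Real.sin (T * ξ)).aestronglyMeasurable
  · exact fun x hx => Set.indicator_apply_nonneg fun _ => div_nonneg (hψ0 x) hx.le
  · intro x hx y hy hxy
    by_cases h : y ≤ N
    · simpa [g, Set.indicator, h, hxy.trans h] using hψa hx hy hxy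
    · have : g y = 0 := by simp [g, h]
      rw [this]
      exact Set.indicator_apply_nonneg fun _ => div_nonneg (hψ0 x) (le_of_lt hx)
  · intro x hx
    simp [g, hx]
  · simp only [hgind]
    rw [IntegrableOn, integrable_indicator_iff measurableSet_Iic, IntegrableOn,
      Measure.restrict_restrict measurableSet_Iic, Set.inter_comm, Set.Ioi_inter_Iic]
    exact hi.integral_prod_left.congr
      ((ae_restrict_mem measurableSet_Ioc).mono fun ξ hξ => key ξ hξ)

/-- Local integrability of `ψ` at `0` from the integrability of `ψ` against `min 1 (1 / |x|)`. -/
lemma integrableOn_Ioc_of_integrable_mul_min {ψ : ℝ → ℝ} (hψm : Measurable ψ)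
    (hψi : Integrable (fun x => ψ x * min 1 (1 / |x|))) {N : ℝ} (hN : 0 < N) :
    IntegrableOn ψ (Set.Ioc 0 N) := by
  have hc : 0 < min 1 (1 / N) := lt_min one_pos (by positivity)
  refine Integrable.mono' ((hψi.norm.const_mul (min 1 (1 / N))⁻¹).integrableOn (s := Set.Ioc 0 N))
    hψm.aestronglyMeasurable ?_
  filter_upwards [ae_restrict_mem measurableSet_Ioc] with x hx
  have hx0 : 0 < x := hx.1
  have hle : min 1 (1 / N) ≤ min 1 (1 / |x|) := by
    rw [abs_of_pos hx0]
    exact min_le_min_left _ (one_div_le_one_div_of_le hx0 hx.2)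
  rw [norm_mul, Real.norm_eq_abs (min _ _), abs_of_pos (hc.trans_le hle), inv_mul_eq_div,
    le_div_iff₀ hc]
  exact mul_le_mul_of_nonneg_left hle (norm_nonneg _)

lemma FT_re_eq {φ : ℝ → ℝ} (hφi : Integrable φ) (hφe : ∀ x, φ (-x) = φ x) (ξ : ℝ) :
    (FT φ ξ).re = 2 * ∫ x in Set.Ioi 0, φ x * Real.cos (x * ξ) := by
  have hexp : ∀ x : ℝ, Complex.exp (-Complex.I * x * ξ)
      = Complex.exp (((-(x * ξ) : ℝ) : ℂ) * Complex.I) := by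
    intro x
    congr 1
    push_cast
    ring
  have hi : Integrable fun x : ℝ => (φ x : ℂ) * Complex.exp (-Complex.I * x * ξ) := by
    refine hφi.ofReal.mul_bdd (c := 1) ?_ ?_
    · exact (by fun_prop : Continuous fun x : ℝ =>
        Complex.exp (-Complex.I * x * ξ)).aestronglyMeasurable
    · refine Filter.Eventually.of_forall fun x => ?_
      rw [hexp, Complex.norm_exp_ofReal_mul_I]
  have habs : ∀ x, φ |x| = φ x := fun x => by
    rcases abs_choice x with h | h <;> rw [h]
    exact hφe x
  rw [← integral_comp_abs (f := fun x => φ x * Real.cos (x * ξ)), FT]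
  change RCLike.re (∫ x : ℝ, (φ x : ℂ) * Complex.exp (-Complex.I * x * ξ)) = _
  rw [← integral_re hi]
  refine integral_congr_ae (Filter.Eventually.of_forall fun x => ?_)
  have hcos : Real.cos (|x| * ξ) = Real.cos (x * ξ) := by
    rcases abs_choice x with h | h <;> rw [h]
    rw [neg_mul, Real.cos_neg]
  simp only [habs, hcos, hexp, RCLike.re_eq_complex_re, Complex.re_ofReal_mul,
    Complex.exp_ofReal_mul_I_re, Real.cos_neg]

/-- let `φ, ψ : ℝ → ℝ` be nonnegative, even, measurable, with `φ`
nonincreasing on `(0,∞)` and `x ↦ ψ(x)/x` nonincreasing on `(0,∞)`.  If `φ` is bounded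
with compact support and `x ↦ ψ(x)·min{1, 1/|x|}` is integrable on `ℝ`, then
`∫_ℝ 𝓕φ(x) ψ(x) dx ≥ 0`. -/
theorem stmt3 (φ ψ : ℝ → ℝ)
    (hφm : Measurable φ) (hψm : Measurable ψ)
    (hφe : ∀ x, φ (-x) = φ x) (hψe : ∀ x, ψ (-x) = ψ x)
    (hφ0 : ∀ x, 0 ≤ φ x) (hψ0 : ∀ x, 0 ≤ ψ x)
    (hφa : AntitoneOn φ (Set.Ioi 0))
    (hψa : AntitoneOn (fun x => ψ x / x) (Set.Ioi 0))
    (hφb : ∃ M, ∀ x, φ x ≤ M) (hφs : HasCompactSupport φ)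
    (hψi : Integrable (fun x => ψ x * min 1 (1 / |x|))) :
    0 ≤ (∫ x : ℝ, FT φ x * (ψ x : ℂ)).re := by
  by_cases hI : Integrable fun x : ℝ => FT φ x * (ψ x : ℂ)
  swap
  · simp [integral_undef hI]
  obtain ⟨M, hM⟩ := hφb
  have hφi : Integrable φ := by
    rw [← integrableOn_iff_integrable_of_support_subset (subset_tsupport φ)]
    refine Integrable.mono' (integrableOn_const (C := M) hφs.measure_lt_top.ne)
      hφm.aestronglyMeasurable (Filter.Eventually.of_forall fun x => ?_)
    rw [Real.norm_eq_abs, abs_of_nonneg (hφ0 x)]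
    exact hM x
  obtain ⟨R, hR⟩ : ∃ R, ∀ x, R < x → φ x = 0 := by
    obtain ⟨R, hR⟩ := hφs.isCompact.bddAbove
    exact ⟨R, fun x hx => image_eq_zero_of_notMem_tsupport fun h => (hR h).not_gt hx⟩
  let C : ℝ → ℝ := fun ξ => ∫ x in Set.Ioi 0, φ x * Real.cos (x * ξ)
  have hre : ∀ ξ, (FT φ ξ * (ψ ξ : ℂ)).re = 2 * C ξ * ψ ξ := by
    intro ξ
    rw [Complex.re_mul_ofReal, FT_re_eq hφi hφe]
  have hIre : Integrable fun ξ => 2 * C ξ * ψ ξ := by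
    simpa only [RCLike.re_eq_complex_re, hre] using hI.re
  have heven : ∀ ξ, 2 * C |ξ| * ψ |ξ| = 2 * C ξ * ψ ξ := by
    intro ξ
    rcases abs_choice ξ with h | h <;> rw [h]
    simp only [C, mul_neg, Real.cos_neg, hψe]
  have hint : (∫ x : ℝ, FT φ x * (ψ x : ℂ)).re = 2 * ∫ ξ in Set.Ioi 0, 2 * C ξ * ψ ξ := by
    rw [← integral_comp_abs (f := fun ξ => 2 * C ξ * ψ ξ)]
    change RCLike.re (∫ x : ℝ, FT φ x * (ψ x : ℂ)) = _
    rw [← integral_re hI]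
    simp only [RCLike.re_eq_complex_re, hre, heven]
  rw [hint]
  refine mul_nonneg zero_le_two ?_
  refine ge_of_tendsto (intervalIntegral_tendsto_integral_Ioi 0 hIre.integrableOn
    Filter.tendsto_id) ?_
  filter_upwards [Filter.eventually_gt_atTop 0] with N hN
  have hψN := integrableOn_Ioc_of_integrable_mul_min hψm hψi hN
  have hprod := integrable_mul_mul_cos hψN (hφi.integrableOn (s := Set.Ioi 0))
  have hswap : ∫ ξ in Set.Ioc 0 N, 2 * C ξ * ψ ξ
      = 2 * ∫ x in Set.Ioi 0, (∫ ξ in Set.Ioc 0 N, ψ ξ * Real.cos (x * ξ)) * φ x := by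
    have hl : ∀ ξ, 2 * C ξ * ψ ξ
        = 2 * ∫ x in Set.Ioi 0, ψ ξ * φ x * Real.cos (x * ξ) := by
      intro ξ
      simp only [C, mul_assoc, integral_const_mul]
      ring
    have hr : ∀ x, (∫ ξ in Set.Ioc 0 N, ψ ξ * Real.cos (x * ξ)) * φ x
        = ∫ ξ in Set.Ioc 0 N, ψ ξ * φ x * Real.cos (x * ξ) := by
      intro x
      simp only [mul_right_comm _ (φ x), integral_mul_const]
    simp only [hl, hr]
    rw [integral_const_mul, integral_integral_swap hprod]
  rw [id, intervalIntegral.integral_of_le hN.le, hswap]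
  refine mul_nonneg zero_le_two ?_
  refine integral_mul_antitoneOn_nonneg hφm ?_ (fun x _ => hφ0 x) hφa hR ?_
    fun T hT => integral_Ioo_truncated_cos_nonneg hψm hψ0 hψa hψN hT
  · have hm : StronglyMeasurable fun p : ℝ × ℝ => ψ p.2 * Real.cos (p.1 * p.2) :=
      (by fun_prop : Measurable fun p : ℝ × ℝ => ψ p.2 * Real.cos (p.1 * p.2)).stronglyMeasurable
    exact hm.integral_prod_right.aestronglyMeasurable
  · refine hprod.integral_prod_right.congr (Filter.Eventually.of_forall fun x => ?_)
    simp only [mul_right_comm _ (φ x), integral_mul_const]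
end

section
/- Let φ : ℝ → ℝ be an even, nonnegative, bounded function with compact support which is nonincreasing on (0,∞). Then there exists a constant C > 0 such that |𝓕φ(x)| ≤ C · min{1, 1/|x|} for all x ∈ ℝ. -/
open MeasureTheory

/-- A bounded measurable function with compact support is integrable. -/
lemma integrable_of_bounded_of_hasCompactSupport {φ : ℝ → ℝ} (hφm : Measurable φ) {M : ℝ}
    (hM : ∀ x, ‖φ x‖ ≤ M) (hφs : HasCompactSupport φ) : Integrable φ := by
  rw [← integrableOn_iff_integrable_of_support_subset (subset_tsupport φ)]
  exact Measure.integrableOn_of_bounded hφs.measure_lt_top.ne hφm.aestronglyMeasurable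
    (Filter.Eventually.of_forall hM)

lemma norm_exp_neg_I_mul (x ξ : ℝ) : ‖Complex.exp (-Complex.I * x * ξ)‖ = 1 := by
  rw [Complex.norm_exp]
  simp

lemma integrable_mul_exp_neg_I {f : ℝ → ℝ} (hf : Integrable f) (ξ : ℝ) :
    Integrable fun x : ℝ => (f x : ℂ) * Complex.exp (-Complex.I * x * ξ) := by
  refine hf.ofReal.mul_bdd (c := 1) ?_ (Filter.Eventually.of_forall fun x => ?_)
  · exact (by fun_prop : Continuous fun x : ℝ =>
      Complex.exp (-Complex.I * x * ξ)).aestronglyMeasurable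
  · exact (norm_exp_neg_I_mul x ξ).le

lemma norm_FT_le (f : ℝ → ℝ) (ξ : ℝ) : ‖FT f ξ‖ ≤ ∫ x, |f x| := by
  refine (norm_integral_le_integral_norm _).trans_eq (integral_congr_ae ?_)
  refine Filter.Eventually.of_forall fun x => ?_
  simp only [norm_mul, norm_exp_neg_I_mul, mul_one, Complex.norm_real, Real.norm_eq_abs]

/-- Translating by a half period bounds the Fourier transform by an `L¹` modulus of continuity. -/
lemma two_mul_norm_FT_le {f : ℝ → ℝ} (hf : Integrable f) {ξ h : ℝ}
    (hh : Complex.exp (-Complex.I * h * ξ) = -1) :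
    2 * ‖FT f ξ‖ ≤ ∫ x, |f x - f (x - h)| := by
  have hshift : FT (fun x => f (x - h)) ξ = -FT f ξ := by
    have h1 := integral_sub_right_eq_self (μ := volume)
      (fun x : ℝ => (f x : ℂ) * Complex.exp (-Complex.I * x * ξ)) h
    unfold FT
    rw [← h1, ← integral_neg]
    congr 1
    ext x
    have h2 : Complex.exp (-Complex.I * x * ξ)
        = Complex.exp (-Complex.I * ((x - h : ℝ) : ℂ) * ξ) * Complex.exp (-Complex.I * h * ξ) := by
      rw [← Complex.exp_add]
      congr 1
      push_cast
      ring
    rw [h2, hh]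
    ring
  have hsub : FT (fun x => f x - f (x - h)) ξ = 2 * FT f ξ := by
    have h3 : FT (fun x => f x - f (x - h)) ξ = FT f ξ - FT (fun x => f (x - h)) ξ := by
      unfold FT
      rw [← integral_sub (integrable_mul_exp_neg_I hf ξ)
        (integrable_mul_exp_neg_I (hf.comp_sub_right h) ξ)]
      congr 1
      ext x
      push_cast
      ring
    rw [h3, hshift]
    ring
  have h4 := norm_FT_le (fun x => f x - f (x - h)) ξ
  rwa [hsub, norm_mul, Complex.norm_ofNat] at h4

/-- The `L¹` modulus of continuity of a bounded even function decreasing on `(0, ∞)`. -/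
lemma integral_abs_sub_translate_le {φ : ℝ → ℝ} (hφ : Integrable φ) {M : ℝ}
    (hφe : ∀ x, φ (-x) = φ x) (hφ0 : ∀ x, 0 ≤ φ x) (hM : ∀ x, φ x ≤ M)
    (hφa : AntitoneOn φ (Set.Ioi 0)) {h : ℝ} (hh : 0 < h) :
    ∫ x, |φ x - φ (x - h)| ≤ 2 * M * h := by
  set g : ℝ → ℝ := (Set.Ioi (0 : ℝ)).indicator φ - (Set.Iic (0 : ℝ)).indicator φ with hg
  have hgi : Integrable g :=
    (hφ.indicator measurableSet_Ioi).sub (hφ.indicator measurableSet_Iic)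
  have hgpos : ∀ x, 0 < x → g x = φ x := fun x hx => by
    simp [hg, hx, hx.not_ge]
  have hgneg : ∀ x, x ≤ 0 → g x = -φ x := fun x hx => by
    simp [hg, hx, hx.not_gt]
  set b : ℝ → ℝ := (Set.Icc 0 h).indicator fun _ => 2 * M with hb
  have hbi : Integrable b :=
    (integrable_indicator_iff measurableSet_Icc).2 (integrableOn_const (by simp))
  have hbint : ∫ x, b x = 2 * M * h := by
    rw [hb, integral_indicator_const _ measurableSet_Icc]
    simp [Measure.real, hh.le, mul_comm]
  have hle : ∀ x, |φ x - φ (x - h)| ≤ (g (x - h) - g x) + b x := by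
    intro x
    rcases lt_or_ge x 0 with hx | hx
    · have hbx : b x = 0 := Set.indicator_of_notMem (fun hm => hx.not_ge hm.1) _
      have hmono : φ (-(x - h)) ≤ φ (-x) :=
        hφa (Set.mem_Ioi.2 (by linarith)) (Set.mem_Ioi.2 (by linarith)) (by linarith)
      rw [hφe, hφe] at hmono
      rw [hgneg x hx.le, hgneg (x - h) (by linarith), hbx, abs_of_nonneg (by linarith)]
      linarith
    · rcases le_or_gt x h with hxh | hxh
      · have hbx : b x = 2 * M := Set.indicator_of_mem (Set.mem_Icc.2 ⟨hx, hxh⟩) _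
        have hgx : g x ≤ φ x := by
          rcases hx.eq_or_lt with h0 | h0
          · rw [hgneg x h0.ge]
            linarith [hφ0 x]
          · exact (hgpos x h0).le
        rw [hgneg (x - h) (by linarith), hbx, abs_le]
        constructor <;> linarith [hM x, hM (x - h), hφ0 x, hφ0 (x - h)]
      · have hbx : b x = 0 := Set.indicator_of_notMem (fun hm => hxh.not_ge hm.2) _
        have hmono : φ x ≤ φ (x - h) :=
          hφa (Set.mem_Ioi.2 (by linarith)) (Set.mem_Ioi.2 (by linarith)) (by linarith)
        rw [hgpos x (by linarith), hgpos (x - h) (by linarith), hbx,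
          abs_of_nonpos (by linarith)]
        linarith
  have hgs : Integrable fun x => g (x - h) := hgi.comp_sub_right h
  have hdiff : Integrable fun x => g (x - h) - g x := hgs.sub hgi
  calc ∫ x, |φ x - φ (x - h)|
      ≤ ∫ x, ((g (x - h) - g x) + b x) :=
        integral_mono (hφ.sub (hφ.comp_sub_right h)).abs (hdiff.add hbi) hle
    _ = 2 * M * h := by
        rw [integral_add hdiff hbi, integral_sub hgs hgi, integral_sub_right_eq_self g h,
          hbint]
        ring

lemma exp_neg_I_half_period {ξ : ℝ} (hξ : ξ ≠ 0) :
    Complex.exp (-Complex.I * ((Real.pi / |ξ| : ℝ) : ℂ) * ξ) = -1 := by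
  have hξc : (ξ : ℂ) ≠ 0 := Complex.ofReal_ne_zero.2 hξ
  rcases abs_choice ξ with h | h
  · have : -Complex.I * ((Real.pi / |ξ| : ℝ) : ℂ) * ξ = -(Real.pi * Complex.I) := by
      rw [h]
      push_cast
      field_simp
    rw [this, Complex.exp_neg, Complex.exp_pi_mul_I]
    norm_num
  · have : -Complex.I * ((Real.pi / |ξ| : ℝ) : ℂ) * ξ = Real.pi * Complex.I := by
      rw [h]
      push_cast
      field_simp
    rw [this, Complex.exp_pi_mul_I]

/-- if `φ : ℝ → ℝ` is even, nonnegative, bounded, measurable, compactly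
supported and nonincreasing on `(0,∞)`, then there is `C > 0` with
`|𝓕φ(x)| ≤ C · min{1, 1/|x|}` for all `x` (equivalently, `|𝓕φ(x)| ≤ C` and
`|x|·|𝓕φ(x)| ≤ C` for all `x`). -/
theorem stmt5 (φ : ℝ → ℝ)
    (hφm : Measurable φ)
    (hφe : ∀ x, φ (-x) = φ x)
    (hφ0 : ∀ x, 0 ≤ φ x)
    (hφb : ∃ M, ∀ x, φ x ≤ M)
    (hφs : HasCompactSupport φ)
    (hφa : AntitoneOn φ (Set.Ioi 0)) :
    ∃ C : ℝ, 0 < C ∧ ∀ x : ℝ, ‖FT φ x‖ ≤ C ∧ |x| * ‖FT φ x‖ ≤ C := by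
  obtain ⟨M, hM⟩ := hφb
  have hM0 : 0 ≤ M := (hφ0 0).trans (hM 0)
  have hφ : Integrable φ := integrable_of_bounded_of_hasCompactSupport hφm
    (fun x => by rw [Real.norm_of_nonneg (hφ0 x)]; exact hM x) hφs
  have hI : 0 ≤ ∫ x, |φ x| := integral_nonneg fun x => abs_nonneg _
  have hMπ : 0 ≤ M * Real.pi := mul_nonneg hM0 Real.pi_pos.le
  refine ⟨1 + (∫ x, |φ x|) + M * Real.pi, by linarith, fun x => ⟨?_, ?_⟩⟩
  · linarith [norm_FT_le φ x]
  · rcases eq_or_ne x 0 with rfl | hx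
    · rw [abs_zero, zero_mul]
      linarith
    · have hx' : 0 < |x| := abs_pos.2 hx
      have h1 := (two_mul_norm_FT_le hφ (exp_neg_I_half_period hx)).trans
        (integral_abs_sub_translate_le hφ hφe hφ0 hM hφa (div_pos Real.pi_pos hx'))
      have h2 : ‖FT φ x‖ ≤ M * (Real.pi / |x|) := by linarith
      calc |x| * ‖FT φ x‖ ≤ |x| * (M * (Real.pi / |x|)) := by gcongr
        _ = M * Real.pi := by field_simp
        _ ≤ _ := by linarith
end
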